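/- The ideal M = ⟨x_1^3x_2^3x_3^3, x_2^3x_4^3, x_1^2x_4^2, x_3^2x_5^2, x_1x_5⟩ in k[x_1,…,x_5] is a generic monomial ideal, its Scarf complex has dimension 2, and hence M is Cohen-Macaulay. -/

import Mathlib

open Finset

open scoped Classical

set_option synthInstance.maxHeartbeats 1000000

/-- The monomial `x^a` in `k[x_1,…,x_n]` with exponent vector `a : Fin n → ℕ`. -/
noncomputable def mono (k : Type*) [CommSemiring k] {n : ℕ} (a : Fin n → ℕ) :
    MvPolynomial (Fin n) k :=
  MvPolynomial.monomial (Finsupp.equivFunOnFinite.symm a) 1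

/-- The monomial ideal generated by the monomials with exponent vectors in `G`. -/
noncomputable def monIdeal (k : Type*) [CommSemiring k] {n : ℕ}
    (G : Finset (Fin n → ℕ)) : Ideal (MvPolynomial (Fin n) k) :=
  Ideal.span ((fun a => mono k a) '' (G : Set (Fin n → ℕ)))

/-- Exponent vector of the lcm of the monomials with exponents in `σ`. -/
def lcmExp {n : ℕ} (σ : Finset (Fin n → ℕ)) : Fin n → ℕ :=
  fun i => σ.sup (fun a => a i)

/-- `c` strictly divides `b`: whenever `c` has positive degree in a variable,
its degree there is strictly smaller than that of `b`. -/
def StrictlyDivides {n : ℕ} (c b : Fin n → ℕ) : Prop :=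
  ∀ i, 0 < c i → c i < b i

/-- `G` is the set of exponent vectors of the minimal generators of a *generic*
monomial ideal: no generator divides another, and for any two distinct
generators with the same positive degree in some variable there is a third
generator strictly dividing their lcm. -/
def IsGeneric {n : ℕ} (G : Finset (Fin n → ℕ)) : Prop :=
  (∀ a ∈ G, ∀ b ∈ G, a ≤ b → a = b) ∧
  ∀ a ∈ G, ∀ b ∈ G, a ≠ b → (∃ h, a h = b h ∧ 0 < a h) →
    ∃ c ∈ G, c ≠ a ∧ c ≠ b ∧ StrictlyDivides c (fun i => max (a i) (b i))

/-- `σ ⊆ G` is a face of the Scarf complex of the monomial ideal with minimal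
generating exponents `G`: its lcm is attained by no other subset of `G`. -/
def ScarfFace {n : ℕ} (G σ : Finset (Fin n → ℕ)) : Prop :=
  σ ⊆ G ∧ ∀ τ ⊆ G, τ ≠ σ → lcmExp τ ≠ lcmExp σ

/-- The dimension (as an integer, so the empty-complex value `-1` is allowed)
of the Scarf complex `Δ_M`: one less than the largest cardinality of a face. -/
noncomputable def scarfDim {n : ℕ} (G : Finset (Fin n → ℕ)) : ℤ :=
  (((G.powerset.filter (fun σ => ScarfFace G σ)).sup Finset.card : ℕ) : ℤ) - 1

/-- `σ` is a face of `V(M)`, the simplicial complex whose Stanley-Reisner ideal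
is `rad M`: no generator of `M` has support contained in `σ`. -/
def VFace {n : ℕ} (G : Finset (Fin n → ℕ)) (σ : Finset (Fin n)) : Prop :=
  ∀ a ∈ G, ¬ (Finset.univ.filter (fun i => 0 < a i) ⊆ σ)

/-- The dimension of `V(M)` as an integer. -/
noncomputable def vDim {n : ℕ} (G : Finset (Fin n → ℕ)) : ℤ :=
  ((((Finset.univ : Finset (Fin n)).powerset.filter (fun σ => VFace G σ)).sup
    Finset.card : ℕ) : ℤ) - 1

/-- The quotient `S/I` of the polynomial ring `S = k[x_1,…,x_n]` is
Cohen-Macaulay: some regular sequence on `S/I` consisting of elements of the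
irrelevant maximal ideal `⟨x_1,…,x_n⟩` has length equal to the Krull dimension
of `S/I`. -/
def IsCMQuotient (k : Type*) [Field k] {n : ℕ}
    (I : Ideal (MvPolynomial (Fin n) k)) : Prop :=
  ∃ rs : List (MvPolynomial (Fin n) k),
    (∀ r ∈ rs, r ∈ Ideal.span (Set.range (MvPolynomial.X : Fin n → MvPolynomial (Fin n) k))) ∧
    RingTheory.Sequence.IsRegular (MvPolynomial (Fin n) k ⧸ I)
      (rs.map (Ideal.Quotient.mk I)) ∧
    (rs.length : WithBot (WithTop ℕ)) = ringKrullDim (MvPolynomial (Fin n) k ⧸ I)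

/-- `x, y` is a weakly regular sequence on `R ⧸ I`. -/
def IsRegularPair {R : Type*} [CommRing R] (I : Ideal R) (x y : R) : Prop :=
  (∀ f, x * f ∈ I → f ∈ I) ∧ ∀ f, y * f ∈ I ⊔ Ideal.span {x} → f ∈ I ⊔ Ideal.span {x}

theorem mem_sup_span_singleton {R : Type*} [CommRing R] {I : Ideal R} {x f : R} :
    f ∈ I ⊔ Ideal.span {x} ↔ ∃ g, f - x * g ∈ I := by
  rw [Submodule.mem_sup]
  constructor
  · rintro ⟨i, hi, z, hz, rfl⟩
    obtain ⟨g, rfl⟩ := Ideal.mem_span_singleton'.1 hz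
    exact ⟨g, by simpa [mul_comm] using hi⟩
  · rintro ⟨g, hg⟩
    exact ⟨_, hg, x * g, Ideal.mul_mem_right _ _ (Ideal.mem_span_singleton_self x), by ring⟩

/-- Regularity passes to the middle of `0 → R ⧸ (I : u) → R ⧸ I → R ⧸ (I + u) → 0`. -/
theorem IsRegularPair.of_colon {R : Type*} [CommRing R] {I J : Ideal R} {x y u : R}
    (hJ : ∀ f, f ∈ J ↔ u * f ∈ I) (h₁ : IsRegularPair J x y)
    (h₂ : IsRegularPair (I ⊔ Ideal.span {u}) x y) : IsRegularPair I x y := by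
  have hle : I ≤ I ⊔ Ideal.span {u} := le_sup_left
  refine ⟨fun f hf => ?_, fun f hf => ?_⟩
  · obtain ⟨h, hh⟩ := mem_sup_span_singleton.1 (h₂.1 f (hle hf))
    have hxh : x * h ∈ J := by
      rw [hJ]
      convert I.sub_mem hf (I.mul_mem_left x hh) using 1
      ring
    have := (hJ h).1 (h₁.1 h hxh)
    convert I.add_mem hh this using 1
    ring
  · have hf' : y * f ∈ (I ⊔ Ideal.span {u}) ⊔ Ideal.span {x} :=
      (sup_le_sup_right hle _) hf
    obtain ⟨g, hg⟩ := mem_sup_span_singleton.1 (h₂.2 f hf')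
    obtain ⟨h, hh⟩ := mem_sup_span_singleton.1 hg
    obtain ⟨g₁, hg₁⟩ := mem_sup_span_singleton.1 hf
    have h3 : x * (g₁ - y * g) ∈ I ⊔ Ideal.span {u} := by
      rw [mem_sup_span_singleton]
      refine ⟨y * h, ?_⟩
      convert I.sub_mem (I.mul_mem_left y hh) hg₁ using 1
      ring
    obtain ⟨h', hh'⟩ := mem_sup_span_singleton.1 (h₂.1 _ h3)
    have h4 : y * h ∈ J ⊔ Ideal.span {x} := by
      rw [mem_sup_span_singleton]
      refine ⟨h', (hJ _).2 ?_⟩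
      convert I.add_mem (I.sub_mem hg₁ (I.mul_mem_left y hh)) (I.mul_mem_left x hh') using 1
      ring
    obtain ⟨v, hv⟩ := mem_sup_span_singleton.1 (h₁.2 _ h4)
    rw [hJ] at hv
    rw [mem_sup_span_singleton]
    refine ⟨g + u * v, ?_⟩
    convert I.add_mem hh hv using 1
    ring

theorem IsRegularPair.isRegular {R : Type*} [CommRing R] {I : Ideal R} {x y : R}
    (h : IsRegularPair I x y) {J : Ideal R} (hJ : J ≠ ⊤) (hI : I ≤ J) (hx : x ∈ J) (hy : y ∈ J) :
    RingTheory.Sequence.IsRegular (R ⧸ I) ([x, y].map (Ideal.Quotient.mk I)) := by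
  have key : ∀ (f : R), Ideal.Quotient.mk I f ∈ Ideal.span {Ideal.Quotient.mk I x} ↔
      f ∈ I ⊔ Ideal.span {x} := by
    intro f
    rw [← Set.image_singleton, ← Ideal.map_span, ← Ideal.mem_comap,
      Ideal.comap_map_of_surjective' _ Ideal.Quotient.mk_surjective, Ideal.mk_ker, sup_comm]
  refine ⟨⟨fun i hi => ?_⟩, ?_⟩
  · rw [isSMulRegular_quotient_iff_mem_of_smul_mem]
    intro q
    obtain ⟨f, rfl⟩ := Ideal.Quotient.mk_surjective q
    have hi' : i < 2 := hi
    interval_cases i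
    · simpa [← map_mul, Ideal.Quotient.eq_zero_iff_mem] using h.1 f
    · simpa [← map_mul, key, Ideal.ofList_singleton] using h.2 f
  · intro htop
    rw [smul_eq_mul, Ideal.mul_top, eq_comm, ← Ideal.map_ofList] at htop
    apply hJ
    have h2 : Ideal.ofList [x, y] ≤ J := by
      simp [Ideal.ofList_cons, Ideal.span_le, hx, hy]
    rw [eq_top_iff, ← Ideal.comap_top (f := Ideal.Quotient.mk I), ← htop,
      Ideal.comap_map_of_surjective' _ Ideal.Quotient.mk_surjective, Ideal.mk_ker]
    exact sup_le h2 hI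

section MonomialIdeals

variable {σ k : Type*} [Field k]

/-- `I` consists of the polynomials all of whose monomials have exponent satisfying `P`. -/
def IsSupportedIdeal (I : Ideal (MvPolynomial σ k)) (P : (σ →₀ ℕ) → Prop) : Prop :=
  ∀ f, f ∈ I ↔ ∀ m ∈ f.support, P m

theorem IsSupportedIdeal.monomial_mem {I : Ideal (MvPolynomial σ k)} {P : (σ →₀ ℕ) → Prop}
    (hI : IsSupportedIdeal I P) {m : σ →₀ ℕ} (hm : P m) (c : k) :
    MvPolynomial.monomial m c ∈ I := by
  rw [hI]
  intro m' hm'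
  rwa [Finset.mem_singleton.1 (MvPolynomial.support_monomial_subset hm')]

theorem IsSupportedIdeal.sup_span_monomial {I : Ideal (MvPolynomial σ k)}
    {P : (σ →₀ ℕ) → Prop} (hI : IsSupportedIdeal I P) (u : σ →₀ ℕ) :
    IsSupportedIdeal (I ⊔ Ideal.span {MvPolynomial.monomial u 1}) (fun m => P m ∨ u ≤ m) := by
  intro f
  constructor
  · intro hf m hm
    obtain ⟨g, hg⟩ := mem_sup_span_singleton.1 hf
    by_cases hu : u ≤ m
    · exact Or.inr hu
    · refine Or.inl ((hI _).1 hg m ?_)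
      simpa [MvPolynomial.coeff_monomial_mul', hu] using hm
  · intro hf
    rw [MvPolynomial.as_sum f]
    refine Ideal.sum_mem _ fun m hm => ?_
    rcases hf m hm with h | h
    · exact Ideal.mem_sup_left (hI.monomial_mem h _)
    · refine Ideal.mem_sup_right (Ideal.mem_span_singleton.2 ?_)
      exact MvPolynomial.monomial_dvd_monomial.2 ⟨Or.inr h, one_dvd _⟩

theorem IsSupportedIdeal.monomial_mul_mem {I : Ideal (MvPolynomial σ k)}
    {P : (σ →₀ ℕ) → Prop} (hI : IsSupportedIdeal I P) (u : σ →₀ ℕ) (f : MvPolynomial σ k) :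
    MvPolynomial.monomial u 1 * f ∈ I ↔ ∀ m ∈ f.support, P (u + m) := by
  rw [hI]
  constructor
  · intro h m hm
    exact h _ (by simpa [MvPolynomial.coeff_monomial_mul] using hm)
  · intro h m hm
    rw [MvPolynomial.mem_support_iff, MvPolynomial.coeff_monomial_mul'] at hm
    have hu : u ≤ m := by by_contra hu; simp [hu] at hm
    rw [← add_tsub_cancel_of_le hu]
    exact h _ (by simpa [hu] using hm)

/-- `x, y` is weakly regular modulo every ideal of polynomials with support in `P`. -/
def RegularOn (x y : MvPolynomial σ k) (P : (σ →₀ ℕ) → Prop) : Prop :=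
  ∀ I, IsSupportedIdeal I P → IsRegularPair I x y

theorem RegularOn.congr {x y : MvPolynomial σ k} {P Q : (σ →₀ ℕ) → Prop}
    (h : RegularOn x y Q) (hPQ : ∀ m, P m ↔ Q m) : RegularOn x y P := by
  rwa [show P = Q from funext fun m => propext (hPQ m)]

theorem RegularOn.split {x y : MvPolynomial σ k} {P Q₁ Q₂ : (σ →₀ ℕ) → Prop} (a : σ) (p : ℕ)
    (h₁ : RegularOn x y Q₁) (h₂ : RegularOn x y Q₂)
    (hQ₁ : ∀ m, P (Finsupp.single a p + m) ↔ Q₁ m)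
    (hQ₂ : ∀ m, P m ∨ p ≤ m a ↔ Q₂ m) : RegularOn x y P := by
  intro I hI
  have hJ : ∀ f, f ∈ Submodule.comap
      (LinearMap.mulLeft (MvPolynomial σ k) (MvPolynomial.monomial (Finsupp.single a p) (1 : k))) I ↔
      MvPolynomial.monomial (Finsupp.single a p) 1 * f ∈ I := fun f => Iff.rfl
  refine IsRegularPair.of_colon hJ (h₁ _ ?_)
    ((h₂.congr fun m => ?_) _ (hI.sup_span_monomial _))
  · intro f
    rw [hJ, hI.monomial_mul_mem]
    simp only [hQ₁]
  · rw [← hQ₂, Finsupp.single_le_iff]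

theorem sub_map_mem {I : Ideal (MvPolynomial σ k)}
    (φ : MvPolynomial σ k →ₐ[k] MvPolynomial σ k)
    (hX : ∀ i, MvPolynomial.X i - φ (MvPolynomial.X i) ∈ I) (f : MvPolynomial σ k) :
    f - φ f ∈ I := by
  rw [← Ideal.Quotient.eq]
  have : Ideal.Quotient.mkₐ k I = (Ideal.Quotient.mkₐ k I).comp φ :=
    MvPolynomial.algHom_ext fun i => Ideal.Quotient.eq.2 (hX i)
  exact DFunLike.congr_fun this f

theorem mem_of_mul_mem {I : Ideal (MvPolynomial σ k)}
    (φ : MvPolynomial σ k →ₐ[k] MvPolynomial σ k)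
    (hX : ∀ i, MvPolynomial.X i - φ (MvPolynomial.X i) ∈ I) (hI : ∀ f ∈ I, φ f = 0)
    {r f : MvPolynomial σ k} (hr : φ r ≠ 0) (hf : r * f ∈ I) : f ∈ I := by
  have h := hI _ hf
  rw [map_mul] at h
  simpa [(mul_eq_zero.1 h).resolve_left hr] using sub_map_mem φ hX f

theorem IsSupportedIdeal.map_eq_zero {I : Ideal (MvPolynomial σ k)} {s : Set σ}
    (hI : IsSupportedIdeal I fun m => ∃ i ∈ s, 1 ≤ m i)
    (φ : MvPolynomial σ k →ₐ[k] MvPolynomial σ k)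
    (hφ : ∀ i ∈ s, φ (MvPolynomial.X i) = 0) : ∀ f ∈ I, φ f = 0 := by
  intro f hf
  rw [MvPolynomial.as_sum f, map_sum]
  refine Finset.sum_eq_zero fun m hm => ?_
  obtain ⟨i, hi, h1⟩ := (hI f).1 hf m hm
  have hd : (MvPolynomial.X i : MvPolynomial σ k) ∣ MvPolynomial.monomial m (f.coeff m) := by
    rw [MvPolynomial.X_dvd_monomial]
    exact Or.inr (by omega)
  simpa [hφ i hi] using map_dvd φ hd

theorem linear_ne_zero {d e : σ} (hde : d ≠ e) {a b : k} (h : a ≠ 0 ∨ b ≠ 0) :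
    (MvPolynomial.C a * MvPolynomial.X d + MvPolynomial.C b * MvPolynomial.X e :
      MvPolynomial σ k) ≠ 0 := by
  intro h0
  have h1 := congrArg (MvPolynomial.coeff (Finsupp.single d 1)) h0
  have h2 := congrArg (MvPolynomial.coeff (Finsupp.single e 1)) h0
  simp [MvPolynomial.coeff_X, Finsupp.single_left_inj, hde, hde.symm] at h1 h2
  tauto

variable [Fintype σ]

/-- The linear form with coefficient vector `α`. -/
noncomputable def linearForm (α : σ → k) : MvPolynomial σ k :=
  ∑ i, MvPolynomial.C (α i) * MvPolynomial.X i

theorem map_linearForm {d e : σ} (hde : d ≠ e) (α : σ → k)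
    (φ : MvPolynomial σ k →ₐ[k] MvPolynomial σ k)
    (hφ : ∀ i, i ≠ d ∧ i ≠ e → φ (MvPolynomial.X i) = 0) :
    φ (linearForm α) = MvPolynomial.C (α d) * φ (MvPolynomial.X d) +
      MvPolynomial.C (α e) * φ (MvPolynomial.X e) := by
  rw [linearForm, map_sum, Fintype.sum_eq_add d e hde]
  · simp [← MvPolynomial.algebraMap_eq]
  · intro i hi
    rw [map_mul, hφ i hi, mul_zero]

/-- Two linear forms that restrict to linearly independent forms in the variables `d, e`
are a regular sequence modulo the other variables. -/
theorem regularOn_prime {d e : σ} (hde : d ≠ e) {α β : σ → k}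
    (hΔ : α e * β d - α d * β e ≠ 0) :
    RegularOn (linearForm α) (linearForm β)
      (fun m => ∃ i ∈ {i | i ≠ d ∧ i ≠ e}, 1 ≤ m i) := by
  intro I hI
  have hXI : ∀ i, i ≠ d ∧ i ≠ e → (MvPolynomial.X i : MvPolynomial σ k) ∈ I := fun i hi =>
    hI.monomial_mem ⟨i, hi, by simp⟩ 1
  have hφ₁ : ∃ φ : MvPolynomial σ k →ₐ[k] MvPolynomial σ k,
      φ (MvPolynomial.X d) = MvPolynomial.X d ∧ φ (MvPolynomial.X e) = MvPolynomial.X e ∧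
      ∀ i, i ≠ d ∧ i ≠ e → φ (MvPolynomial.X i) = 0 := by
    refine ⟨MvPolynomial.aeval fun i => if i = d ∨ i = e then MvPolynomial.X i else 0, ?_⟩
    refine ⟨by simp, by simp, fun i hi => by simp [hi]⟩
  obtain ⟨φ₁, hd₁, he₁, h0₁⟩ := hφ₁
  have hsub₁ : ∀ f, f - φ₁ f ∈ I := by
    apply sub_map_mem
    intro i
    by_cases hd : i = d
    · simp [hd, hd₁]
    by_cases he : i = e
    · simp [he, he₁]
    simpa [h0₁ i ⟨hd, he⟩] using hXI i ⟨hd, he⟩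
  have hx : φ₁ (linearForm α) = MvPolynomial.C (α d) * MvPolynomial.X d +
      MvPolynomial.C (α e) * MvPolynomial.X e := by
    rw [map_linearForm hde α φ₁ h0₁, hd₁, he₁]
  have hα : α d ≠ 0 ∨ α e ≠ 0 := by
    by_contra! h
    simp [h] at hΔ
  have hβ : β d ≠ 0 ∨ β e ≠ 0 := by
    by_contra! h
    simp [h] at hΔ
  refine ⟨fun f hf => ?_, fun f hf => ?_⟩
  · refine mem_of_mul_mem φ₁ (fun i => hsub₁ _) (hI.map_eq_zero φ₁ h0₁) ?_ hf
    rw [hx]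
    exact linear_ne_zero hde hα
  · set T : MvPolynomial σ k := MvPolynomial.C (α e * β d - α d * β e)⁻¹ *
      (MvPolynomial.C (β d) * MvPolynomial.X d + MvPolynomial.C (β e) * MvPolynomial.X e) with hT
    have hT0 : T ≠ 0 := mul_ne_zero (by simpa using hΔ) (linear_ne_zero hde hβ)
    have hφ₂ : ∃ φ : MvPolynomial σ k →ₐ[k] MvPolynomial σ k,
        φ (MvPolynomial.X d) = MvPolynomial.C (α e) * T ∧
        φ (MvPolynomial.X e) = -MvPolynomial.C (α d) * T ∧
        ∀ i, i ≠ d ∧ i ≠ e → φ (MvPolynomial.X i) = 0 := by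
      refine ⟨MvPolynomial.aeval fun i => if i = d then MvPolynomial.C (α e) * T else
        if i = e then -MvPolynomial.C (α d) * T else 0, ?_⟩
      refine ⟨by simp, by simp [hde.symm], fun i hi => by simp [hi]⟩
    obtain ⟨φ₂, hd₂, he₂, h0₂⟩ := hφ₂
    have hΔC : MvPolynomial.C (σ := σ) (α e * β d - α d * β e)⁻¹ *
        (MvPolynomial.C (α e) * MvPolynomial.C (β d) -
          MvPolynomial.C (α d) * MvPolynomial.C (β e)) = 1 := by
      rw [← map_mul, ← map_mul, ← map_sub, ← map_mul, inv_mul_cancel₀ hΔ, map_one]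
    refine mem_of_mul_mem φ₂ (fun i => ?_) (fun g hg => ?_) ?_ hf
    · by_cases hd : i = d
      · subst hd
        rw [hd₂, mem_sup_span_singleton]
        refine ⟨-(MvPolynomial.C (α e * β i - α i * β e)⁻¹ * MvPolynomial.C (β e)), ?_⟩
        have := I.mul_mem_left (MvPolynomial.C (α e * β i - α i * β e)⁻¹ * MvPolynomial.C (β e))
          (hsub₁ (linearForm α))
        rw [hx] at this
        convert this using 1
        rw [hT]
        linear_combination (-MvPolynomial.X i) * hΔC
      · by_cases he : i = e
        · subst he
          rw [he₂, mem_sup_span_singleton]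
          refine ⟨MvPolynomial.C (α i * β d - α d * β i)⁻¹ * MvPolynomial.C (β d), ?_⟩
          have := I.mul_mem_left (-(MvPolynomial.C (α i * β d - α d * β i)⁻¹ *
            MvPolynomial.C (β d))) (hsub₁ (linearForm α))
          rw [hx] at this
          convert this using 1
          rw [hT]
          linear_combination (-MvPolynomial.X i) * hΔC
        · simpa [h0₂ i ⟨hd, he⟩] using Ideal.mem_sup_left (hXI i ⟨hd, he⟩)
    · obtain ⟨q, hq⟩ := mem_sup_span_singleton.1 hg
      have h1 := hI.map_eq_zero φ₂ h0₂ _ hq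
      rw [map_sub, map_mul, map_linearForm hde α φ₂ h0₂, hd₂, he₂] at h1
      linear_combination h1
    · rw [map_linearForm hde β φ₂ h0₂, hd₂, he₂]
      convert mul_ne_zero (MvPolynomial.C_ne_zero.2 hΔ) hT0 using 1
      simp only [map_sub, map_mul]
      ring

theorem regularOn_powers {d e : σ} (hde : d ≠ e) {α β : σ → k}
    (hΔ : α e * β d - α d * β e ≠ 0) (w : σ → ℕ) :
    RegularOn (linearForm α) (linearForm β) (fun m => ∃ i, (i ≠ d ∧ i ≠ e) ∧ w i ≤ m i) := by
  induction hN : ∑ i, w i using Nat.strong_induction_on generalizing w with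
  | _ N ih =>
  by_cases h0 : ∃ i, (i ≠ d ∧ i ≠ e) ∧ w i = 0
  · obtain ⟨i, hi, hw⟩ := h0
    intro I hI
    have : I = ⊤ := by
      rw [Ideal.eq_top_iff_one, hI]
      exact fun m _ => ⟨i, hi, by simp [hw]⟩
    simp [IsRegularPair, this]
  push Not at h0
  by_cases h2 : ∃ i, (i ≠ d ∧ i ≠ e) ∧ 2 ≤ w i
  · obtain ⟨i, hi, hw⟩ := h2
    have hlt : ∀ c < w i, ∑ j, Function.update w i c j < N := by
      intro c hc
      rw [← hN]
      refine Finset.sum_lt_sum (fun j _ => ?_) ⟨i, Finset.mem_univ i, by simpa⟩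
      rcases eq_or_ne j i with rfl | hj
      · simpa using hc.le
      · simp [hj]
    refine RegularOn.split i 1 (ih _ (hlt (w i - 1) (by omega)) _ rfl)
      (ih _ (hlt 1 (by omega)) _ rfl) (fun m => ?_) (fun m => ?_)
    · refine exists_congr fun j => and_congr_right fun _ => ?_
      rcases eq_or_ne j i with rfl | hj
      · simp; omega
      · simp [hj]
    · constructor
      · rintro (⟨j, hj, hm⟩ | hm)
        · refine ⟨j, hj, ?_⟩
          rcases eq_or_ne j i with rfl | hji
          · simp; omega
          · simpa [hji]
        · exact ⟨i, hi, by simpa using hm⟩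
      · rintro ⟨j, hj, hm⟩
        rcases eq_or_ne j i with rfl | hji
        · exact Or.inr (by simpa using hm)
        · exact Or.inl ⟨j, hj, by simpa [hji] using hm⟩
  · push Not at h2
    refine (regularOn_prime hde hΔ).congr fun m => exists_congr fun i => ?_
    refine and_congr_right fun hi => ?_
    have := h0 i hi
    have := h2 i hi
    rw [show w i = 1 by omega]

end MonomialIdeals

section Dimension

variable {σ k : Type*} [Field k]

theorem killCompl_surjective (s : Finset σ) :
    Function.Surjective (MvPolynomial.killCompl (R := k) (Subtype.val_injective (p := (· ∈ s)))) :=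
  fun g => ⟨MvPolynomial.rename Subtype.val g, MvPolynomial.killCompl_rename_app _ g⟩

theorem ringKrullDim_quotient_ker_killCompl (s : Finset σ) :
    ringKrullDim (MvPolynomial σ k ⧸ RingHom.ker
      (MvPolynomial.killCompl (R := k) (Subtype.val_injective (p := (· ∈ s)))).toRingHom) =
      s.card := by
  rw [ringKrullDim_eq_of_ringEquiv (RingHom.quotientKerEquivOfSurjective
    (f := (MvPolynomial.killCompl (R := k) (Subtype.val_injective (p := (· ∈ s)))).toRingHom)
    (killCompl_surjective s))]
  simp

theorem ker_killCompl_le {s : Finset σ} {p : Ideal (MvPolynomial σ k)}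
    (hp : ∀ i ∉ s, MvPolynomial.X i ∈ p) :
    RingHom.ker (MvPolynomial.killCompl (R := k)
      (Subtype.val_injective (p := (· ∈ s)))).toRingHom ≤ p := by
  intro f hf
  have hf0 : MvPolynomial.killCompl (R := k) (Subtype.val_injective (p := (· ∈ s))) f = 0 := hf
  have := sub_map_mem (I := p) ((MvPolynomial.rename Subtype.val).comp
    (MvPolynomial.killCompl (R := k) (Subtype.val_injective (p := (· ∈ s))))) (fun i => ?_) f
  · simpa [hf0] using this
  · by_cases hi : i ∈ s
    · have := MvPolynomial.killCompl_rename_app (R := k)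
        (Subtype.val_injective (p := (· ∈ s))) (MvPolynomial.X ⟨i, hi⟩)
      rw [MvPolynomial.rename_X] at this
      simp [this]
    · simpa [MvPolynomial.killCompl, hi] using hp i hi

theorem ringKrullDim_quotient_le_of_primes {I : Ideal (MvPolynomial σ k)} {d : ℕ}
    (h : ∀ p : Ideal (MvPolynomial σ k), p.IsPrime → I ≤ p →
      ∃ s : Finset σ, s.card ≤ d ∧ ∀ i ∉ s, MvPolynomial.X i ∈ p) :
    ringKrullDim (MvPolynomial σ k ⧸ I) ≤ d := by
  rw [ringKrullDim_quotient, Order.krullDim]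
  refine iSup_le fun c => ?_
  obtain ⟨s, hs, hX⟩ := h c.head.1.asIdeal c.head.1.isPrime c.head.2
  have hle := ker_killCompl_le hX
  have hd := ringKrullDim_quotient_ker_killCompl (k := k) s
  rw [ringKrullDim_quotient] at hd
  let c' : LTSeries (PrimeSpectrum.zeroLocus (R := MvPolynomial σ k)
      (RingHom.ker (MvPolynomial.killCompl (R := k)
        (Subtype.val_injective (p := (· ∈ s)))).toRingHom)) :=
    ⟨c.length, fun i => ⟨(c i).1, fun f hf => (c.head_le i) (hle hf)⟩, fun i => c.step i⟩
  calc (c.length : WithBot ℕ∞) = c'.length := rfl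
    _ ≤ _ := Order.LTSeries.length_le_krullDim c'
    _ = s.card := hd
    _ ≤ d := by exact_mod_cast hs

theorem card_le_ringKrullDim_quotient {I : Ideal (MvPolynomial σ k)} (s : Finset σ)
    (h : I ≤ RingHom.ker (MvPolynomial.killCompl (R := k)
      (Subtype.val_injective (p := (· ∈ s)))).toRingHom) :
    (s.card : WithBot ℕ∞) ≤ ringKrullDim (MvPolynomial σ k ⧸ I) := by
  rw [← ringKrullDim_quotient_ker_killCompl (k := k) s]
  exact ringKrullDim_le_of_surjective (Ideal.Quotient.factor h)
    (Ideal.Quotient.factor_surjective h)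

end Dimension

/-- A generator dividing the lcm of the others in `σ` obstructs `σ` from being a Scarf face. -/
theorem not_scarfFace_of_le {n : ℕ} {G σ τ : Finset (Fin n → ℕ)} {c : Fin n → ℕ} (hc : c ∈ G)
    (hτ : τ ⊆ σ) (hcτ : c ∉ τ) (hle : ∀ i, c i ≤ lcmExp τ i) : ¬ ScarfFace G σ := by
  rintro ⟨hσ, h⟩
  have hle' : ∀ i, c i ≤ lcmExp (σ.erase c) i := fun i => (hle i).trans
    (Finset.sup_mono fun x hx => Finset.mem_erase.2 ⟨fun hxc => hcτ (hxc ▸ hx), hτ hx⟩)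
  have hins : lcmExp (insert c σ) = lcmExp (σ.erase c) := by
    ext i
    have : insert c σ = insert c (σ.erase c) := by ext; simp; tauto
    rw [this]
    simpa [lcmExp] using hle' i
  by_cases hcσ : c ∈ σ
  · refine h (σ.erase c) ((Finset.erase_subset _ _).trans hσ)
      (Finset.erase_ne_self.2 hcσ) ?_
    exact hins.symm.trans (by rw [Finset.insert_eq_of_mem hcσ])
  · refine h (insert c σ) (Finset.insert_subset hc hσ)
      (Finset.insert_ne_self.2 hcσ) ?_
    exact hins.trans (by rw [Finset.erase_eq_of_notMem hcσ])

/-- Exponents of `x₁³x₂³x₃³, x₂³x₄³, x₁²x₄², x₃²x₅², x₁x₅`. -/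
local notation "treeGens" => ({![3,3,3,0,0], ![0,3,0,3,0], ![2,0,0,2,0], ![0,0,2,0,2], ![1,0,0,0,1]} : Finset (Fin 5 → ℕ))

theorem isGeneric_treeGens : IsGeneric treeGens := by
  refine ⟨?_, ?_⟩
  · simp [Pi.le_def, Fin.forall_fin_succ]
  · simp [StrictlyDivides, Fin.forall_fin_succ, Fin.exists_fin_succ]

theorem scarfFace_treeGens :
    ScarfFace treeGens {![0,3,0,3,0], ![0,0,2,0,2], ![1,0,0,0,1]} := by
  refine ⟨by decide, fun τ hτ hne heq => hne ?_⟩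
  have hle : ∀ a ∈ τ, a 0 ≤ 1 := by
    intro a ha
    refine (Finset.le_sup (f := fun a : Fin 5 → ℕ => a 0) ha).trans ?_
    change lcmExp τ 0 ≤ 1
    rw [heq]
    decide
  have hsub : τ ⊆ {![0,3,0,3,0], ![0,0,2,0,2], ![1,0,0,0,1]} := by
    intro a ha
    have h0 := hle a ha
    have hG := hτ ha
    simp only [Finset.mem_insert, Finset.mem_singleton] at hG ⊢
    rcases hG with rfl | rfl | rfl | rfl | rfl <;> simp at h0 ⊢
  refine hsub.antisymm fun a ha => by_contra fun haτ => ?_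
  have hlt : ∀ a ∈ ({![0,3,0,3,0], ![0,0,2,0,2], ![1,0,0,0,1]} : Finset (Fin 5 → ℕ)),
      ∃ i, lcmExp (({![0,3,0,3,0], ![0,0,2,0,2], ![1,0,0,0,1]} : Finset (Fin 5 → ℕ)).erase a) i <
        lcmExp {![0,3,0,3,0], ![0,0,2,0,2], ![1,0,0,0,1]} i := by
    decide
  obtain ⟨i, hi⟩ := hlt a ha
  rw [← heq] at hi
  exact hi.not_ge (Finset.sup_mono (Finset.subset_erase.2 ⟨hsub, haτ⟩))

theorem scarfDim_treeGens : scarfDim treeGens = 2 := by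
  have hsup : ((Finset.powerset treeGens).filter (fun σ => ScarfFace treeGens σ)).sup
      Finset.card = 3 := by
    apply le_antisymm
    · refine Finset.sup_le fun σ hσ => ?_
      obtain ⟨hsub, hface⟩ := Finset.mem_filter.1 hσ
      have h12 : ¬ {![3,3,3,0,0], ![0,3,0,3,0]} ⊆ σ := fun h =>
        not_scarfFace_of_le (c := ![2,0,0,2,0]) (by simp) h (by decide) (by decide) hface
      have h14 : ¬ {![3,3,3,0,0], ![0,0,2,0,2]} ⊆ σ := fun h =>
        not_scarfFace_of_le (c := ![1,0,0,0,1]) (by simp) h (by decide) (by decide) hface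
      have h34 : ¬ {![2,0,0,2,0], ![0,0,2,0,2]} ⊆ σ := fun h =>
        not_scarfFace_of_le (c := ![1,0,0,0,1]) (by simp) h (by decide) (by decide) hface
      have hcover : ∃ τ : Finset (Fin 5 → ℕ), τ.card ≤ 3 ∧ σ ⊆ τ := by
        by_cases h1 : ![3,3,3,0,0] ∈ σ
        · refine ⟨{![3,3,3,0,0], ![2,0,0,2,0], ![1,0,0,0,1]}, by decide, fun a ha => ?_⟩
          have := Finset.mem_powerset.1 hsub ha
          grind
        by_cases h3 : ![2,0,0,2,0] ∈ σ
        · refine ⟨{![0,3,0,3,0], ![2,0,0,2,0], ![1,0,0,0,1]}, by decide, fun a ha => ?_⟩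
          have := Finset.mem_powerset.1 hsub ha
          grind
        · refine ⟨{![0,3,0,3,0], ![0,0,2,0,2], ![1,0,0,0,1]}, by decide, fun a ha => ?_⟩
          have := Finset.mem_powerset.1 hsub ha
          grind
      obtain ⟨τ, hτ, h⟩ := hcover
      exact (Finset.card_le_card h).trans hτ
    · refine le_trans (by decide) (Finset.le_sup (f := Finset.card) (Finset.mem_filter.2
        ⟨Finset.mem_powerset.2 scarfFace_treeGens.1, scarfFace_treeGens⟩))
  rw [scarfDim, hsup]
  rfl

theorem isSupportedIdeal_monIdeal {k : Type*} [Field k] {n : ℕ} {G : Finset (Fin n → ℕ)} :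
    IsSupportedIdeal (monIdeal k G) (fun m => ∃ a ∈ G, a ≤ ⇑m) := by
  intro f
  have : (fun a => mono k a) '' (G : Set (Fin n → ℕ)) =
      (fun s => MvPolynomial.monomial s 1) '' (Finsupp.equivFunOnFinite.symm '' (G : Set _)) := by
    rw [Set.image_image]; rfl
  rw [monIdeal, this, MvPolynomial.mem_ideal_span_monomial_image]
  simp only [Set.exists_mem_image, Finset.mem_coe]
  rfl

theorem monIdeal_le {k : Type*} [Field k] {n : ℕ} {G : Finset (Fin n → ℕ)}
    {J : Ideal (MvPolynomial (Fin n) k)}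
    (h : ∀ a ∈ G, ∃ i, a i ≠ 0 ∧ MvPolynomial.X i ∈ J) : monIdeal k G ≤ J := by
  rw [monIdeal, Ideal.span_le]
  rintro _ ⟨a, ha, rfl⟩
  obtain ⟨i, h0, hi⟩ := h a ha
  exact J.mem_of_dvd (MvPolynomial.X_dvd_monomial.2 (Or.inr h0)) hi

theorem isRegularPair_treeGens (k : Type*) [Field k] :
    IsRegularPair (monIdeal k treeGens) (linearForm ![1,1,0,1,0]) (linearForm ![1,0,1,0,1]) := by
  have hab := regularOn_powers (d := 0) (e := 1) (by decide)
    (α := (![1,1,0,1,0] : Fin 5 → k)) (β := ![1,0,1,0,1]) (by simp)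
  have hac := regularOn_powers (d := 0) (e := 2) (by decide)
    (α := (![1,1,0,1,0] : Fin 5 → k)) (β := ![1,0,1,0,1]) (by simp)
  have hbc := regularOn_powers (d := 1) (e := 2) (by decide)
    (α := (![1,1,0,1,0] : Fin 5 → k)) (β := ![1,0,1,0,1]) (by simp)
  have hcd := regularOn_powers (d := 2) (e := 3) (by decide)
    (α := (![1,1,0,1,0] : Fin 5 → k)) (β := ![1,0,1,0,1]) (by simp)
  have hde := regularOn_powers (d := 3) (e := 4) (by decide)
    (α := (![1,1,0,1,0] : Fin 5 → k)) (β := ![1,0,1,0,1]) (by simp)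
  have hbe := regularOn_powers (d := 1) (e := 4) (by decide)
    (α := (![1,1,0,1,0] : Fin 5 → k)) (β := ![1,0,1,0,1]) (by simp)
  simp only [Fin.exists_fin_succ] at hab hac hbc hcd hde hbe
  simp at hab hac hbc hcd hde hbe
  have h₀ : RegularOn (linearForm (![1,1,0,1,0] : Fin 5 → k)) (linearForm ![1,0,1,0,1]) fun m =>
      1 ≤ m 0 ∨ 3 ≤ m 1 ∧ 3 ≤ m 3 ∨ 2 ≤ m 2 ∧ 2 ≤ m 4 := by
    refine .split 1 3 (Q₁ := fun m => 1 ≤ m 0 ∨ 3 ≤ m 3 ∨ 2 ≤ m 2 ∧ 2 ≤ m 4)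
      (Q₂ := fun m => 1 ≤ m 0 ∨ 3 ≤ m 1 ∨ 2 ≤ m 2 ∧ 2 ≤ m 4)
      (.split 2 2 (hbc ![1,0,0,3,2]) (hbe ![1,0,2,3,0]) ?_ ?_)
      (.split 2 2 (hcd ![1,3,0,0,2]) (hde ![1,3,2,0,0]) ?_ ?_) ?_ ?_
    all_goals intro m; simp; try omega
  have h₁ : RegularOn (linearForm (![1,1,0,1,0] : Fin 5 → k)) (linearForm ![1,0,1,0,1]) fun m =>
      1 ≤ m 4 ∨ 1 ≤ m 0 ∨ 3 ≤ m 1 ∧ 1 ≤ m 3 := by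
    refine .split 1 3 (hbc ![1,0,0,1,1]) (hcd ![1,3,0,0,1]) ?_ ?_
    all_goals intro m; simp; try omega
  have h₂ : RegularOn (linearForm (![1,1,0,1,0] : Fin 5 → k)) (linearForm ![1,0,1,0,1]) fun m =>
      1 ≤ m 4 ∨ 2 ≤ m 3 ∨ 2 ≤ m 0 ∧ 3 ≤ m 1 ∧ 3 ≤ m 2 := by
    refine .split 0 2 (Q₁ := fun m => 1 ≤ m 4 ∨ 2 ≤ m 3 ∨ 3 ≤ m 1 ∧ 3 ≤ m 2)
      (.split 1 3 (hab ![0,0,3,2,1]) (hac ![0,3,0,2,1]) ?_ ?_) (hbc ![2,0,0,2,1]) ?_ ?_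
    all_goals intro m; simp; try omega
  have h : RegularOn (linearForm (![1,1,0,1,0] : Fin 5 → k)) (linearForm ![1,0,1,0,1]) fun m =>
      3 ≤ m 0 ∧ 3 ≤ m 1 ∧ 3 ≤ m 2 ∨ 3 ≤ m 1 ∧ 3 ≤ m 3 ∨
        2 ≤ m 0 ∧ 2 ≤ m 3 ∨ 2 ≤ m 2 ∧ 2 ≤ m 4 ∨ 1 ≤ m 0 ∧ 1 ≤ m 4 := by
    refine .split 0 1 (.split 3 2 h₁ h₂ (P := fun m => 1 ≤ m 4 ∨
      2 ≤ m 0 ∧ 3 ≤ m 1 ∧ 3 ≤ m 2 ∨ 3 ≤ m 1 ∧ 3 ≤ m 3 ∨ 1 ≤ m 0 ∧ 2 ≤ m 3) ?_ ?_) h₀ ?_ ?_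
    all_goals intro m; simp; try omega
  refine h.congr (fun m => ?_) _ isSupportedIdeal_monIdeal
  simp [Pi.le_def, Fin.forall_fin_succ]

theorem dim_treeGens (k : Type*) [Field k] :
    ringKrullDim (MvPolynomial (Fin 5) k ⧸ monIdeal k treeGens) = 2 := by
  apply le_antisymm
  · refine ringKrullDim_quotient_le_of_primes (d := 2) fun p hp hle => ?_
    have hmem : ∀ a ∈ treeGens, ∃ i, a i ≠ 0 ∧ (MvPolynomial.X i : MvPolynomial (Fin 5) k) ∈ p := by
      intro a ha
      have h1 : mono k a ∈ p := hle (Ideal.subset_span ⟨a, ha, rfl⟩)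
      rw [mono, MvPolynomial.monomial_eq, map_one, one_mul, Finsupp.prod_fintype _ _ (by simp),
        hp.prod_mem_iff] at h1
      obtain ⟨i, -, hi⟩ := h1
      have h0 : a i ≠ 0 := by
        intro h0
        simp [h0] at hi
        exact hp.ne_top ((Ideal.eq_top_iff_one _).2 hi)
      exact ⟨i, h0, hp.mem_of_pow_mem _ hi⟩
    simp [Fin.exists_fin_succ] at hmem
    by_contra! hcon
    have h1 := hcon {0, 1} (by decide)
    have h2 := hcon {0, 2} (by decide)
    have h3 := hcon {1, 2} (by decide)
    have h4 := hcon {2, 3} (by decide)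
    have h5 := hcon {3, 4} (by decide)
    have h6 := hcon {1, 4} (by decide)
    simp [Fin.exists_fin_succ] at h1 h2 h3 h4 h5 h6
    generalize (MvPolynomial.X 0 ∈ p) = P₀ at *
    generalize (MvPolynomial.X 1 ∈ p) = P₁ at *
    generalize (MvPolynomial.X 2 ∈ p) = P₂ at *
    generalize (MvPolynomial.X 3 ∈ p) = P₃ at *
    generalize (MvPolynomial.X 4 ∈ p) = P₄ at *
    grind
  · have := card_le_ringKrullDim_quotient (I := monIdeal k treeGens) {3, 4} ?_
    · simpa using this
    · refine monIdeal_le fun a ha => ?_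
      have : ∃ i ∉ ({3, 4} : Finset (Fin 5)), a i ≠ 0 := by
        revert a
        simp [Fin.exists_fin_succ]
      obtain ⟨i, hi, h0⟩ := this
      exact ⟨i, h0, by simpa [RingHom.mem_ker, MvPolynomial.killCompl] using hi⟩

/-- The ideal
`M = ⟨x₁³x₂³x₃³, x₂³x₄³, x₁²x₄², x₃²x₅², x₁x₅⟩` in `k[x₁,…,x₅]` is a generic
monomial ideal, its Scarf complex has dimension 2, and `M` is Cohen-Macaulay. -/
theorem example_tree_graph_CM (k : Type*) [Field k] :
    IsGeneric ({![3,3,3,0,0], ![0,3,0,3,0], ![2,0,0,2,0], ![0,0,2,0,2],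
      ![1,0,0,0,1]} : Finset (Fin 5 → ℕ)) ∧
    scarfDim ({![3,3,3,0,0], ![0,3,0,3,0], ![2,0,0,2,0], ![0,0,2,0,2],
      ![1,0,0,0,1]} : Finset (Fin 5 → ℕ)) = 2 ∧
    IsCMQuotient k (monIdeal k ({![3,3,3,0,0], ![0,3,0,3,0], ![2,0,0,2,0],
      ![0,0,2,0,2], ![1,0,0,0,1]} : Finset (Fin 5 → ℕ))) := by
  have hlin : ∀ α : Fin 5 → k, linearForm α ∈
      Ideal.span (Set.range (MvPolynomial.X : Fin 5 → MvPolynomial (Fin 5) k)) := fun α =>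
    Ideal.sum_mem _ fun i _ => Ideal.mul_mem_left _ _ (Ideal.subset_span ⟨i, rfl⟩)
  refine ⟨isGeneric_treeGens, scarfDim_treeGens,
    [linearForm ![1,1,0,1,0], linearForm ![1,0,1,0,1]], by simp [hlin], ?_, ?_⟩
  · refine (isRegularPair_treeGens k).isRegular (J := MvPolynomial.idealOfVars (Fin 5) k)
      ?_ ?_ (hlin _) (hlin _)
    · rw [Ideal.ne_top_iff_one, ← pow_one (MvPolynomial.idealOfVars (Fin 5) k),
        MvPolynomial.mem_pow_idealOfVars_iff]
      simp
    · refine monIdeal_le fun a ha => ?_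
      have : ∃ i, a i ≠ 0 := by
        revert a
        simp [Fin.exists_fin_succ]
      obtain ⟨i, hi⟩ := this
      exact ⟨i, hi, Ideal.subset_span ⟨i, rfl⟩⟩
  · rw [dim_treeGens]; rfl
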